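/- arXiv:2403.04033 — 10 statements merged into one kernel-verified Lean document; each statement's English description precedes it below -/
import Mathlib

section
/- Let F_0 be a class of functions from A × X to [−1,1], let (a_1,x_1),…,(a_T,x_T) ∈ A × X, let ẑ_1,…,ẑ_T ∈ ℝ, let R > 0, and for each t ∈ [T] let F_t := {f ∈ F_0 : Σ_{s=1}^{t−1} (f(a_s,x_s) − ẑ_s)² ≤ R} be the version space at time t. Then for every ε > 0, the number of rounds on which the width of the version space at the played point exceeds ε is bounded: Σ_{t=1}^T 1{Δ_{F_t}(a_t,x_t) > ε} ≤ (4R/ε² + 1) · E(F_0, ε). -/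
/-- Width of a class of real-valued functions at a point:
`Δ_G(s) = sup_{g,g' ∈ G} (g(s) - g'(s))`. -/
noncomputable def fnWidth {S : Type*} (G : Set (S → ℝ)) (s : S) : ℝ :=
  sSup {y : ℝ | ∃ g ∈ G, ∃ g' ∈ G, y = g s - g' s}

/-- `(q)` is ε-dependent, w.r.t. the class `F`, on the subsequence of `p` indexed by the
finite index set `I`: every `f, f' ∈ F` with `√(∑_{i ∈ I} (f(p i) - f'(p i))²) ≤ ε`
also satisfies `f q - f' q ≤ ε`. -/
def epsDep {S : Type*} (F : Set (S → ℝ)) (ε : ℝ) (p : ℕ → S) (I : Finset ℕ) (q : S) : Prop :=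
  ∀ f ∈ F, ∀ f' ∈ F,
    Real.sqrt (∑ i ∈ I, (f (p i) - f' (p i)) ^ 2) ≤ ε → f q - f' q ≤ ε

/-- There is a sequence of length `n` such that, for some `ε' > ε`, every element is
`ε'`-independent of its predecessors w.r.t. `F` (the defining property of the
eluder dimension at scale `ε`). -/
def eluderSeq {S : Type*} (F : Set (S → ℝ)) (ε : ℝ) (n : ℕ) : Prop :=
  ∃ ε' > ε, ∃ p : ℕ → S, ∀ i < n, ¬ epsDep F ε' p (Finset.range i) (p i)

/-- A finite set of indices, each of which is `ε'`-independent of the smaller ones for some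
`ε' > ε`, enumerates in increasing order to an eluder sequence at scale `ε`. -/
lemma eluderSeq_card {S : Type*} (F : Set (S → ℝ)) {ε ε' : ℝ} (hε : ε < ε') (p : ℕ → S)
    (B : Finset ℕ) (hB : ∀ t ∈ B, ¬ epsDep F ε' p (B.filter (· < t)) (p t)) :
    eluderSeq F ε B.card := by
  suffices h : ∃ q : ℕ → S, (∀ i < B.card, ¬ epsDep F ε' q (Finset.range i) (q i)) ∧
      ∀ g : S → ℝ, ∑ i ∈ Finset.range B.card, g (q i) = ∑ s ∈ B, g (p s) by
    obtain ⟨q, hq, -⟩ := h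
    exact ⟨ε', hε, q, hq⟩
  induction B using Finset.induction_on_max with
  | empty => exact ⟨p, by simp, by simp⟩
  | insert a B ha ih =>
    have ha' : a ∉ B := fun h => lt_irrefl _ (ha a h)
    obtain ⟨q, hq, hsum⟩ := ih fun t ht => by
      have h := hB t (Finset.mem_insert_of_mem ht)
      rwa [Finset.filter_insert, if_neg (ha t ht).not_gt] at h
    have hqa : ∀ n ≤ B.card, ∀ g : S → ℝ,
        ∑ i ∈ Finset.range n, g (Function.update q B.card (p a) i) =
          ∑ i ∈ Finset.range n, g (q i) := fun n hn g =>
      Finset.sum_congr rfl fun i hi => by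
        rw [Function.update_of_ne ((Finset.mem_range.1 hi).trans_le hn).ne]
    refine ⟨Function.update q B.card (p a), ?_, fun g => ?_⟩
    · intro i hi
      rw [Finset.card_insert_of_notMem ha', Nat.lt_succ_iff] at hi
      intro hdep
      rcases hi.lt_or_eq with hlt | rfl
      · refine hq i hlt fun f hf f' hf' h => ?_
        have := hdep f hf f' hf' (by rwa [hqa i hi (fun x => (f x - f' x) ^ 2)])
        rwa [Function.update_of_ne hlt.ne] at this
      · refine hB a (Finset.mem_insert_self _ _) fun f hf f' hf' h => ?_
        have hfil : (insert a B).filter (· < a) = B := by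
          rw [Finset.filter_insert, if_neg (lt_irrefl a), Finset.filter_true_of_mem ha]
        rw [hfil] at h
        have := hdep f hf f' hf' (by
          rwa [hqa _ le_rfl (fun x => (f x - f' x) ^ 2), hsum (fun x => (f x - f' x) ^ 2)])
        rwa [Function.update_self] at this
    · rw [Finset.card_insert_of_notMem ha', Finset.sum_range_succ, hqa _ le_rfl,
        Function.update_self, hsum, Finset.sum_insert ha', add_comm]

/-- If the width of a class at a point exceeds a positive number, two of its members differ by
more than that number there. -/
lemma exists_lt_sub_of_lt_fnWidth {S : Type*} {G : Set (S → ℝ)} {s : S} {ε : ℝ} (hε : 0 < ε)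
    (h : ε < fnWidth G s) : ∃ g ∈ G, ∃ g' ∈ G, ε < g s - g' s := by
  unfold fnWidth at h
  obtain hne | hne := Set.eq_empty_or_nonempty {y : ℝ | ∃ g ∈ G, ∃ g' ∈ G, y = g s - g' s}
  · rw [hne, Real.sSup_empty] at h
    exact absurd h hε.not_gt
  · obtain ⟨_, ⟨g, hg, g', hg', rfl⟩, hlt⟩ := exists_lt_of_lt_csSup hne h
    exact ⟨g, hg, g', hg', hlt⟩

/-- If each element of `V` is `ε`-independent of at least one of any `K` disjoint sets of its
predecessors, then `V` splits into `K` classes such that each element is `ε`-independent of its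
predecessors in its class. -/
lemma exists_coloring_not_epsDep {S : Type*} (F : Set (S → ℝ)) (ε : ℝ) (p : ℕ → S)
    (V : Finset ℕ) (K : ℕ)
    (hV : ∀ t ∈ V, ∀ c : ℕ → ℕ, ∃ k < K,
      ¬ epsDep F ε p ((V.filter (· < t)).filter (c · = k)) (p t)) (n : ℕ) :
    ∃ c : ℕ → ℕ, ∀ t ∈ V, t < n → c t < K ∧
      ¬ epsDep F ε p ((V.filter (· < t)).filter (c · = c t)) (p t) := by
  induction n with
  | zero => exact ⟨id, by simp⟩
  | succ n ih =>
    obtain ⟨c, hc⟩ := ih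
    by_cases hn : n ∈ V
    · obtain ⟨k, hk, hdep⟩ := hV n hn c
      have hfil : ∀ t ≤ n, ∀ j, (V.filter (· < t)).filter (Function.update c n k · = j) =
          (V.filter (· < t)).filter (c · = j) := fun t ht j =>
        Finset.filter_congr fun s hs => by
          rw [Function.update_of_ne ((Finset.mem_filter.1 hs).2.trans_le ht).ne]
      refine ⟨Function.update c n k, fun t ht htn => ?_⟩
      rw [hfil t (Nat.lt_succ_iff.1 htn)]
      rcases (Nat.lt_succ_iff.1 htn).lt_or_eq with hlt | rfl
      · rw [Function.update_of_ne hlt.ne]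
        exact hc t ht hlt
      · rw [Function.update_self]
        exact ⟨hk, hdep⟩
    · refine ⟨c, fun t ht htn => hc t ht ?_⟩
      exact (Nat.lt_succ_iff.1 htn).lt_of_ne fun h => hn (h ▸ ht)

/-- Two functions whose squared distance to common targets on the points `p s`, `s ∈ I`, is at most `R`
have squared distance at most `4 * R`. -/
lemma sum_sq_sub_le_four_mul {S : Type*} {f f' : S → ℝ} {p : ℕ → S} {z : ℕ → ℝ} {I : Finset ℕ}
    {R : ℝ} (hf : ∑ s ∈ I, (f (p s) - z s) ^ 2 ≤ R)
    (hf' : ∑ s ∈ I, (f' (p s) - z s) ^ 2 ≤ R) :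
    ∑ s ∈ I, (f (p s) - f' (p s)) ^ 2 ≤ 4 * R := by
  calc ∑ s ∈ I, (f (p s) - f' (p s)) ^ 2
      ≤ ∑ s ∈ I, (2 * (f (p s) - z s) ^ 2 + 2 * (f' (p s) - z s) ^ 2) :=
        Finset.sum_le_sum fun s _ => by
          nlinarith [sq_nonneg (f (p s) - z s + (f' (p s) - z s))]
    _ ≤ 4 * R := by
        rw [Finset.sum_add_distrib, ← Finset.mul_sum, ← Finset.mul_sum]
        linarith

/-- If two members of `F` differ by more than `ε` at `q`, and `q` is `ε`-dependent on each of
`K` colour classes of `I`, then their squared distance on `I` is at least `K * ε ^ 2`. -/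
lemma mul_sq_le_sum_of_epsDep {S : Type*} {F : Set (S → ℝ)} {ε : ℝ} (hε : 0 < ε) {p : ℕ → S}
    {q : S} {f f' : S → ℝ} (hf : f ∈ F) (hf' : f' ∈ F) (hq : ε < f q - f' q)
    (I : Finset ℕ) (c : ℕ → ℕ) (K : ℕ)
    (hdep : ∀ k < K, epsDep F ε p (I.filter (c · = k)) q) :
    K * ε ^ 2 ≤ ∑ s ∈ I, (f (p s) - f' (p s)) ^ 2 := by
  have hclass : ∀ k ∈ Finset.range K,
      ε ^ 2 ≤ ∑ s ∈ I.filter (c · = k), (f (p s) - f' (p s)) ^ 2 := fun k hk => by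
    by_contra! h
    refine hq.not_ge (hdep k (Finset.mem_range.1 hk) f hf f' hf' ?_)
    exact (Real.sqrt_le_left hε.le).2 h.le
  calc (K : ℝ) * ε ^ 2 = ∑ _k ∈ Finset.range K, ε ^ 2 := by simp
    _ ≤ ∑ k ∈ Finset.range K, ∑ s ∈ I.filter (c · = k), (f (p s) - f' (p s)) ^ 2 :=
        Finset.sum_le_sum hclass
    _ ≤ ∑ s ∈ I, (f (p s) - f' (p s)) ^ 2 :=
        Finset.sum_fiberwise_le_sum_of_sum_fiber_nonneg fun _ _ =>
          Finset.sum_nonneg fun _ _ => sq_nonneg _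

/-- with version spaces
`F_t = {f ∈ F_0 : ∑_{s<t} (f(a_s,x_s) - ẑ_s)² ≤ R}`, the number of rounds `t < T` on which
the width of the version space at the played point exceeds `ε` is at most
`(4R/ε² + 1) · E(F_0, ε)`, where `d = E(F_0, ε)` is the eluder dimension (the greatest
length of an eluder sequence at scale `ε`). -/
theorem width_violation_bound
    {A X : Type*} (F0 : Set (A × X → ℝ))
    (hbdd : ∀ f ∈ F0, ∀ p : A × X, f p ∈ Set.Icc (-1 : ℝ) 1)
    (T : ℕ) (p : ℕ → A × X) (zhat : ℕ → ℝ) (R : ℝ) (hR : 0 < R)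
    (Fc : ℕ → Set (A × X → ℝ))
    (hFc : ∀ t, Fc t = {f ∈ F0 | ∑ s ∈ Finset.range t, (f (p s) - zhat s) ^ 2 ≤ R})
    (ε : ℝ) (hε : 0 < ε) (d : ℕ)
    (hd : IsGreatest {n : ℕ | eluderSeq F0 ε n} d) :
    (((Finset.range T).filter (fun t => ε < fnWidth (Fc t) (p t))).card : ℝ)
      ≤ (4 * R / ε ^ 2 + 1) * d := by
  set V := (Finset.range T).filter (fun t => ε < fnWidth (Fc t) (p t))
  obtain ⟨ε', hgap, hε'⟩ : ∃ ε', (∀ t ∈ V, ∃ f ∈ Fc t, ∃ f' ∈ Fc t, ε' < f (p t) - f' (p t)) ∧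
      ε < ε' := by
    have hev : ∀ᶠ ε' in nhdsWithin ε (Set.Ioi ε),
        ∀ t ∈ V, ∃ f ∈ Fc t, ∃ f' ∈ Fc t, ε' < f (p t) - f' (p t) := by
      refine (Filter.eventually_all_finset V).2 fun t ht => ?_
      obtain ⟨f, hf, f', hf', hlt⟩ :=
        exists_lt_sub_of_lt_fnWidth hε (Finset.mem_filter.1 ht).2
      filter_upwards [Ioo_mem_nhdsGT hlt] with x hx
      exact ⟨f, hf, f', hf', hx.2⟩
    exact (hev.and self_mem_nhdsWithin).exists
  have hindep : ∀ t ∈ V, ∀ c : ℕ → ℕ, ∃ k < ⌊4 * R / ε ^ 2⌋₊ + 1,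
      ¬ epsDep F0 ε' p ((V.filter (· < t)).filter (c · = k)) (p t) := by
    intro t ht c
    by_contra! hdep
    obtain ⟨f, hf, f', hf', hlt⟩ := hgap t ht
    rw [hFc] at hf hf'
    have hlow := mul_sq_le_sum_of_epsDep (hε.trans hε') hf.1 hf'.1 hlt _ c _ hdep
    have hsub : ∑ s ∈ V.filter (· < t), (f (p s) - f' (p s)) ^ 2 ≤
        ∑ s ∈ Finset.range t, (f (p s) - f' (p s)) ^ 2 :=
      Finset.sum_le_sum_of_subset_of_nonneg
        (fun s hs => Finset.mem_range.2 (Finset.mem_filter.1 hs).2) fun _ _ _ => sq_nonneg _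
    have hup := hlow.trans (hsub.trans (sum_sq_sub_le_four_mul hf.2 hf'.2))
    have hK : 4 * R / ε ^ 2 < ((⌊4 * R / ε ^ 2⌋₊ + 1 : ℕ) : ℝ) := by
      rw [Nat.cast_succ]
      exact Nat.lt_floor_add_one _
    rw [div_lt_iff₀ (by positivity)] at hK
    have hmono : ((⌊4 * R / ε ^ 2⌋₊ + 1 : ℕ) : ℝ) * ε ^ 2 ≤
        ((⌊4 * R / ε ^ 2⌋₊ + 1 : ℕ) : ℝ) * ε' ^ 2 := by gcongr
    linarith
  obtain ⟨c, hc⟩ := exists_coloring_not_epsDep F0 ε' p V _ hindep T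
  replace hc := fun t (ht : t ∈ V) =>
    hc t ht (Finset.mem_range.1 (Finset.mem_filter.1 ht).1)
  have hcard : V.card ≤ d * (Finset.range (⌊4 * R / ε ^ 2⌋₊ + 1)).card := by
    refine Finset.card_le_mul_card_image_of_maps_to (f := c)
      (fun t ht => Finset.mem_range.2 (hc t ht).1) d fun k _ => ?_
    refine hd.2 (eluderSeq_card F0 hε' p _ fun t ht => ?_)
    obtain ⟨htV, rfl⟩ := Finset.mem_filter.1 ht
    rw [Finset.filter_comm]
    exact (hc t htV).2
  rw [Finset.card_range] at hcard
  calc (V.card : ℝ) ≤ d * (⌊4 * R / ε ^ 2⌋₊ + 1) := by exact_mod_cast hcard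
    _ ≤ d * (4 * R / ε ^ 2 + 1) := by
        gcongr
        exact Nat.floor_le (by positivity)
    _ = (4 * R / ε ^ 2 + 1) * d := mul_comm _ _
end

section
/- Let F_0 be a class of functions from A × X to [−1,1], let (a_1,x_1),…,(a_{t−1},x_{t−1}) ∈ A × X, let ẑ_1,…,ẑ_{t−1} ∈ ℝ, let R > 0, and let F_t := {f ∈ F_0 : Σ_{s=1}^{t−1} (f(a_s,x_s) − ẑ_s)² ≤ R}. Let ε > 0 and suppose there exist f, f' ∈ F_t with f(a_t,x_t) − f'(a_t,x_t) > ε for some pair (a_t,x_t). If (a_t,x_t) is ε-dependent with respect to F_t on each of N pairwise disjoint subsequences of (a_1,x_1),…,(a_{t−1},x_{t−1}), then N < 4R/ε². -/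
/-- Two vectors within squared distance `R` of a common centre are within squared distance `4R`
of each other. -/
theorem sum_sub_sq_le_four_mul {ι : Type*} (T : Finset ι) (u v z : ι → ℝ) {R : ℝ}
    (hu : ∑ i ∈ T, (u i - z i) ^ 2 ≤ R) (hv : ∑ i ∈ T, (v i - z i) ^ 2 ≤ R) :
    ∑ i ∈ T, (u i - v i) ^ 2 ≤ 4 * R := by
  calc ∑ i ∈ T, (u i - v i) ^ 2
      ≤ ∑ i ∈ T, (2 * (u i - z i) ^ 2 + 2 * (v i - z i) ^ 2) :=
        Finset.sum_le_sum fun i _ => by nlinarith [sq_nonneg ((u i - z i) + (v i - z i))]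
    _ = 2 * ∑ i ∈ T, (u i - z i) ^ 2 + 2 * ∑ i ∈ T, (v i - z i) ^ 2 := by
        rw [Finset.sum_add_distrib, Finset.mul_sum, Finset.mul_sum]
    _ ≤ 4 * R := by linarith

/-- Functions that are more than `ε` apart at `q` are more than `ε` apart in root of sum of squares
on every subsequence on which `q` is ε-dependent. -/
theorem epsDep.sq_lt_sum {S : Type*} {F : Set (S → ℝ)} {ε : ℝ} {p : ℕ → S} {I : Finset ℕ} {q : S}
    (h : epsDep F ε p I q) (hε : 0 ≤ ε) {f f' : S → ℝ} (hf : f ∈ F) (hf' : f' ∈ F)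
    (hlt : ε < f q - f' q) : ε ^ 2 < ∑ i ∈ I, (f (p i) - f' (p i)) ^ 2 :=
  (Real.lt_sqrt hε).1 (lt_of_not_ge fun hle => (h f hf f' hf' hle).not_gt hlt)

/-- if the version space
`F_t = {f ∈ F_0 : ∑_{s < t} (f(a_s,x_s) - ẑ_s)² ≤ R}` contains `f, f'` with
`f(a_t,x_t) - f'(a_t,x_t) > ε`, and `(a_t,x_t)` is ε-dependent w.r.t. `F_t` on each of `N`
pairwise disjoint subsequences of its predecessors, then `N < 4R/ε²`. -/
theorem dependence_count_bound
    {A X : Type*} (F0 : Set (A × X → ℝ))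
    (hbdd : ∀ f ∈ F0, ∀ p : A × X, f p ∈ Set.Icc (-1 : ℝ) 1)
    (t : ℕ) (p : ℕ → A × X) (zhat : ℕ → ℝ) (R : ℝ) (hR : 0 < R)
    (Ft : Set (A × X → ℝ))
    (hFt : Ft = {f ∈ F0 | ∑ s ∈ Finset.range t, (f (p s) - zhat s) ^ 2 ≤ R})
    (ε : ℝ) (hε : 0 < ε) (q : A × X)
    (hwide : ∃ f ∈ Ft, ∃ f' ∈ Ft, ε < f q - f' q)
    (N : ℕ) (S : Fin N → Finset ℕ)
    (hsub : ∀ j, S j ⊆ Finset.range t)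
    (hdisj : ∀ j k, j ≠ k → Disjoint (S j) (S k))
    (hdep : ∀ j, epsDep Ft ε p (S j) q) :
    (N : ℝ) < 4 * R / ε ^ 2 := by
  obtain ⟨f, hf, f', hf', hlt⟩ := hwide
  rw [lt_div_iff₀ (pow_pos hε 2)]
  rcases Nat.eq_zero_or_pos N with rfl | hN
  · simpa using hR
  have : Nonempty (Fin N) := ⟨⟨0, hN⟩⟩
  have hfR := hf
  have hfR' := hf'
  rw [hFt] at hfR hfR'
  calc (N : ℝ) * ε ^ 2 = ∑ _j : Fin N, ε ^ 2 := by simp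
    _ < ∑ j : Fin N, ∑ i ∈ S j, (f (p i) - f' (p i)) ^ 2 :=
        Finset.sum_lt_sum_of_nonempty Finset.univ_nonempty
          fun j _ => (hdep j).sq_lt_sum hε.le hf hf' hlt
    _ = ∑ i ∈ Finset.univ.biUnion S, (f (p i) - f' (p i)) ^ 2 :=
        (Finset.sum_biUnion fun j _ k _ hjk => hdisj j k hjk).symm
    _ ≤ ∑ i ∈ Finset.range t, (f (p i) - f' (p i)) ^ 2 :=
        Finset.sum_le_sum_of_subset_of_nonneg
          (Finset.biUnion_subset.2 fun j _ => hsub j) fun _ _ _ => sq_nonneg _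
    _ ≤ 4 * R :=
        sum_sub_sq_le_four_mul _ (fun i => f (p i)) (fun i => f' (p i)) zhat hfR.2 hfR'.2
end

section
/- Let F be a class of functions on A × X, let ε > 0, and suppose the eluder dimension d := E(F, ε) is finite and positive. Then for every k ∈ ℕ and every sequence (a_1,x_1),…,(a_k,x_k) of pairs in A × X, there exists an index j ≤ k such that (a_j,x_j) is ε-dependent with respect to F on at least ⌈k/d − 1⌉ pairwise disjoint subsequences of its predecessors (a_1,x_1),…,(a_{j−1},x_{j−1}). -/
open Filter Topology in
/-- Independence at scale `ε` persists at all slightly larger scales. -/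
theorem eventually_not_epsDep {S : Type*} {F : Set (S → ℝ)} {ε : ℝ} {p : ℕ → S}
    {I : Finset ℕ} {q : S} (h : ¬ epsDep F ε p I q) :
    ∀ᶠ ε' in 𝓝[>] ε, ¬ epsDep F ε' p I q := by
  simp only [epsDep, not_forall, not_le] at h
  obtain ⟨f, hf, f', hf', hle, hlt⟩ := h
  filter_upwards [Ioo_mem_nhdsGT hlt] with ε' hε' hdep
  exact absurd (hdep f hf f' hf' (hle.trans hε'.1.le)) (not_le.2 hε'.2)

theorem image_nth_range_eq_filter (I : Finset ℕ) {n : ℕ} (hn : n < I.card) :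
    (Finset.range n).image (Nat.nth (· ∈ I)) = I.filter (· < Nat.nth (· ∈ I) n) := by
  have hfin : (Set.ofPred (· ∈ I)).Finite := I.finite_toSet
  have hcard : hfin.toFinset.card = I.card := by
    congr 1
    ext a
    exact hfin.mem_toFinset
  ext a
  simp only [Finset.mem_image, Finset.mem_range, Finset.mem_filter]
  constructor
  · rintro ⟨m, hm, rfl⟩
    exact ⟨Nat.nth_mem_of_lt_card (p := (· ∈ I)) hfin (by omega),
      Nat.nth_lt_nth_of_lt_card (p := (· ∈ I)) hfin hm (by omega)⟩
  · rintro ⟨ha, hlt⟩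
    obtain ⟨m, hm, rfl⟩ := Nat.exists_lt_card_finite_nth_eq (p := (· ∈ I)) hfin ha
    refine ⟨m, ?_, rfl⟩
    by_contra! hnm
    exact absurd (Nat.nth_le_nth_of_lt_card (p := (· ∈ I)) hfin hnm hm) (not_le.2 hlt)

open Filter Topology in
/-- A finite subsequence each of whose elements is independent of the preceding ones
witnesses that its length is at most the eluder dimension. -/
theorem eluderSeq_card_s4 {S : Type*} {F : Set (S → ℝ)} {ε : ℝ} {p : ℕ → S} {I : Finset ℕ}
    (h : ∀ i ∈ I, ¬ epsDep F ε p (I.filter (· < i)) (p i)) :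
    eluderSeq F ε I.card := by
  have hfin : (Set.ofPred (· ∈ I)).Finite := I.finite_toSet
  have hcard : hfin.toFinset.card = I.card := by
    congr 1
    ext a
    exact hfin.mem_toFinset
  have hev : ∀ᶠ ε' in 𝓝[>] ε, ∀ i ∈ I, ¬ epsDep F ε' p (I.filter (· < i)) (p i) :=
    (Finset.eventually_all I).2 fun i hi => eventually_not_epsDep (h i hi)
  obtain ⟨ε', hind, hε'⟩ := (hev.and self_mem_nhdsWithin).exists
  refine ⟨ε', hε', fun n => p (Nat.nth (· ∈ I) n), fun n hn hdep => ?_⟩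
  refine hind (Nat.nth (· ∈ I) n)
    (Nat.nth_mem_of_lt_card (p := (· ∈ I)) hfin (by omega)) fun f hf f' hf' hle => ?_
  refine hdep f hf f' hf' ?_
  rwa [← image_nth_range_eq_filter I hn, Finset.sum_image] at hle
  intro a ha b hb hab
  simp only [Finset.coe_range, Set.mem_Iio] at ha hb
  exact Nat.nth_injOn (p := (· ∈ I)) hfin (Set.mem_Iio.2 (by omega))
    (Set.mem_Iio.2 (by omega)) hab

/-- If no element among the first `k` is dependent on each of `K` pairwise disjoint
subsequences of its predecessors, then the first `k` indices can be partitioned into `K`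
subsequences in which every element is independent of the preceding ones. -/
theorem exists_partition_independent {S : Type*} {F : Set (S → ℝ)} {ε : ℝ} {p : ℕ → S}
    {k K : ℕ}
    (h : ∀ j < k, ∀ B : Fin K → Finset ℕ, (∀ i, B i ⊆ Finset.range j) →
      (∀ i i', i ≠ i' → Disjoint (B i) (B i')) → ∃ i, ¬ epsDep F ε p (B i) (p j)) :
    ∃ B : Fin K → Finset ℕ, (∀ i, B i ⊆ Finset.range k) ∧
      (∀ i i', i ≠ i' → Disjoint (B i) (B i')) ∧ ∑ i, (B i).card = k ∧
      ∀ i, ∀ m ∈ B i, ¬ epsDep F ε p ((B i).filter (· < m)) (p m) := by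
  induction k with
  | zero => exact ⟨fun _ => ∅, by simp⟩
  | succ j ih =>
    obtain ⟨B, hsub, hdisj, hsum, hind⟩ := ih fun j' hj' => h j' (by omega)
    obtain ⟨i₀, hi₀⟩ := h j (by omega) B hsub hdisj
    have hj : ∀ i, j ∉ B i := fun i hi => by simpa using hsub i hi
    have hlt : ∀ i, ∀ m ∈ B i, m < j := fun i m hm => by simpa using hsub i hm
    refine ⟨Function.update B i₀ (insert j (B i₀)), fun i => ?_, fun i i' hne => ?_, ?_,
      fun i => ?_⟩
    · intro m hm
      rcases eq_or_ne i i₀ with rfl | hi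
      · simp only [Function.update_self, Finset.mem_insert] at hm
        rcases hm with rfl | hm
        · simp
        · exact Finset.mem_range.2 ((hlt _ m hm).trans j.lt_succ_self)
      · rw [Function.update_of_ne hi] at hm
        exact Finset.mem_range.2 ((hlt _ m hm).trans j.lt_succ_self)
    · rcases eq_or_ne i i₀ with rfl | hi
      · rw [Function.update_self, Function.update_of_ne hne.symm, Finset.disjoint_insert_left]
        exact ⟨hj i', hdisj i i' hne⟩
      · rcases eq_or_ne i' i₀ with rfl | hi'
        · rw [Function.update_self, Function.update_of_ne hi, Finset.disjoint_insert_right]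
          exact ⟨hj i, hdisj i i' hne⟩
        · rw [Function.update_of_ne hi, Function.update_of_ne hi']
          exact hdisj i i' hne
    · have hcard : ∀ i, (Function.update B i₀ (insert j (B i₀)) i).card =
          (B i).card + if i = i₀ then 1 else 0 := by
        intro i
        rcases eq_or_ne i i₀ with rfl | hi
        · simp [hj]
        · simp [hi]
      simp [hcard, Finset.sum_add_distrib, hsum]
    · rcases eq_or_ne i i₀ with rfl | hi
      · rw [Function.update_self]
        intro m hm
        rcases Finset.mem_insert.1 hm with rfl | hm
        · rwa [Finset.filter_insert, if_neg (lt_irrefl _), Finset.filter_true_of_mem (hlt i)]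
        · rw [Finset.filter_insert, if_neg (hlt i m hm).not_gt]
          exact hind i m hm
      · rw [Function.update_of_ne hi]
        exact hind i

theorem toNat_ceil_div_sub_one_mul_lt {k d : ℕ} (hk : 1 ≤ k) (hd : 0 < d) :
    ⌈(k : ℝ) / d - 1⌉.toNat * d < k := by
  have hd' : (0 : ℝ) < d := by exact_mod_cast hd
  rcases le_or_gt ⌈(k : ℝ) / d - 1⌉ 0 with hK | hK
  · rw [Int.toNat_of_nonpos hK]
    omega
  · have hcast : ((⌈(k : ℝ) / d - 1⌉.toNat : ℕ) : ℝ) = ((⌈(k : ℝ) / d - 1⌉ : ℤ) : ℝ) := by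
      exact_mod_cast congrArg (Int.cast : ℤ → ℝ) (Int.toNat_of_nonneg hK.le)
    have hlt := Int.ceil_lt_add_one ((k : ℝ) / d - 1)
    rw [sub_add_cancel, ← hcast, lt_div_iff₀ hd'] at hlt
    exact_mod_cast hlt

/-- if the eluder dimension `d = E(F, ε)` is finite and positive, then in any
sequence of `k ≥ 1` pairs there is an index `j` such that the `j`-th pair is ε-dependent
w.r.t. `F` on at least `⌈k/d - 1⌉` pairwise disjoint subsequences of its predecessors. -/
theorem exists_heavily_dependent_element
    {A X : Type*} (F : Set (A × X → ℝ)) (ε : ℝ) (hε : 0 < ε)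
    (d : ℕ) (hd : IsGreatest {n : ℕ | eluderSeq F ε n} d) (hdpos : 0 < d)
    (k : ℕ) (hk : 1 ≤ k) (p : ℕ → A × X) :
    ∃ j < k, ∃ S : Fin (⌈(k : ℝ) / d - 1⌉.toNat) → Finset ℕ,
      (∀ i, S i ⊆ Finset.range j) ∧
      (∀ i i', i ≠ i' → Disjoint (S i) (S i')) ∧
      (∀ i, epsDep F ε p (S i) (p j)) := by
  by_contra! hcon
  obtain ⟨B, -, -, hsum, hind⟩ := exists_partition_independent (F := F) (ε := ε) (p := p) hcon
  have hle : ∑ i, (B i).card ≤ ∑ _i : Fin (⌈(k : ℝ) / d - 1⌉.toNat), d :=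
    Finset.sum_le_sum fun i _ => hd.2 (eluderSeq_card_s4 (hind i))
  rw [hsum, Finset.sum_const, Finset.card_univ, Fintype.card_fin, smul_eq_mul] at hle
  exact absurd hle (not_le.2 (toNat_ceil_div_sub_one_mul_lt hk hdpos))
end

section
/- Let W be a nonempty set of vectors in ℝ^d with ‖w‖ ≤ 1 for all w ∈ W, let b > 0, and let ã ∈ ℝ^d satisfy inf_{w ∈ W} ⟨w, ã⟩ ≤ b. Set Δ_W(ã) := sup_{w,w' ∈ W} ⟨w − w', ã⟩ and α := b / (b + Δ_W(ã)). Then the scaled action α ã is pessimistically safe: for every w ∈ W, ⟨w, α ã⟩ ≤ b. -/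
open RealInnerProductSpace

/-- Width of a set of linear-constraint parameters at an action:
`Δ_W(a) = sup_{w,w' ∈ W} ⟨w - w', a⟩`. -/
noncomputable def linWidth {d : ℕ} (W : Set (EuclideanSpace ℝ (Fin d)))
    (a : EuclideanSpace ℝ (Fin d)) : ℝ :=
  sSup {y : ℝ | ∃ w ∈ W, ∃ w' ∈ W, y = ⟪w - w', a⟫}

theorem bddAbove_inner_sub {d : ℕ} {W : Set (EuclideanSpace ℝ (Fin d))}
    (hW : ∀ w ∈ W, ‖w‖ ≤ 1) (a : EuclideanSpace ℝ (Fin d)) :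
    BddAbove {y : ℝ | ∃ w ∈ W, ∃ w' ∈ W, y = ⟪w - w', a⟫} := by
  refine ⟨2 * ‖a‖, ?_⟩
  rintro _ ⟨w, hw, w', hw', rfl⟩
  refine (real_inner_le_norm _ _).trans ?_
  gcongr
  linarith [norm_sub_le w w', hW w hw, hW w' hw']

theorem inner_sub_le_linWidth {d : ℕ} {W : Set (EuclideanSpace ℝ (Fin d))}
    (hW : ∀ w ∈ W, ‖w‖ ≤ 1) (a : EuclideanSpace ℝ (Fin d))
    {w w' : EuclideanSpace ℝ (Fin d)} (hw : w ∈ W) (hw' : w' ∈ W) :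
    ⟪w - w', a⟫ ≤ linWidth W a :=
  le_csSup (bddAbove_inner_sub hW a) ⟨w, hw, w', hw', rfl⟩

/-- if `W` is a nonempty set of unit-norm-bounded vectors, `b > 0`, and
`inf_{w ∈ W} ⟨w, ã⟩ ≤ b` (ã is optimistically feasible), then the scaled action
`(b / (b + Δ_W(ã))) • ã` is pessimistically safe: `⟨w, α ã⟩ ≤ b` for every `w ∈ W`. -/
theorem scaled_action_pessimistically_safe
    {d : ℕ} (W : Set (EuclideanSpace ℝ (Fin d))) (hne : W.Nonempty)
    (hW : ∀ w ∈ W, ‖w‖ ≤ 1) (b : ℝ) (hb : 0 < b)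
    (atil : EuclideanSpace ℝ (Fin d))
    (hopt : sInf {y : ℝ | ∃ w ∈ W, y = ⟪w, atil⟫} ≤ b) :
    ∀ w ∈ W, ⟪w, (b / (b + linWidth W atil)) • atil⟫ ≤ b := by
  intro w hw
  have h_nonneg : 0 ≤ linWidth W atil := by
    simpa using inner_sub_le_linWidth hW atil hw hw
  have h_inf : ⟪w, atil⟫ - linWidth W atil ≤ sInf {y : ℝ | ∃ w ∈ W, y = ⟪w, atil⟫} := by
    refine le_csInf ⟨_, w, hw, rfl⟩ ?_
    rintro _ ⟨w', hw', rfl⟩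
    have h := inner_sub_le_linWidth hW atil hw hw'
    rw [inner_sub_left] at h
    linarith
  rw [real_inner_smul_right, div_mul_eq_mul_div, div_le_iff₀ (by linarith)]
  gcongr
  linarith
end

section
/- Let W be a nonempty set of vectors in ℝ^d with ‖w‖ ≤ 1 for all w ∈ W, let b > 0, D_a > 0, D_ℓ ≥ 0, and let ã ∈ ℝ^d satisfy ‖ã‖ ≤ D_a and inf_{w ∈ W} ⟨w, ã⟩ ≤ b. Let γ ∈ [0,1] satisfy γ ≥ b / (b + Δ_W(ã)), and let ℓ : ℝ^d → ℝ be D_ℓ-Lipschitz. Then the loss increase caused by scaling the action into the pessimistic set is controlled by the width at the scaled action: ℓ(γ ã) − ℓ(ã) ≤ (D_ℓ D_a / b) · Δ_W(γ ã). -/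
open RealInnerProductSpace

theorem linWidth_nonneg {d : ℕ} {W : Set (EuclideanSpace ℝ (Fin d))} (hne : W.Nonempty)
    (a : EuclideanSpace ℝ (Fin d)) : 0 ≤ linWidth W a := by
  obtain ⟨w, hw⟩ := hne
  exact Real.sSup_nonneg' ⟨0, ⟨w, hw, w, hw, by simp⟩, le_rfl⟩

theorem linWidth_smul {d : ℕ} (W : Set (EuclideanSpace ℝ (Fin d))) {c : ℝ} (hc : 0 ≤ c)
    (a : EuclideanSpace ℝ (Fin d)) : linWidth W (c • a) = c * linWidth W a := by
  unfold linWidth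
  rw [← smul_eq_mul, ← Real.sSup_smul_of_nonneg hc]
  congr 1
  ext y
  simp only [Set.mem_smul_set, Set.mem_ofPred_eq, smul_eq_mul, inner_smul_right]
  constructor
  · rintro ⟨w, hw, w', hw', rfl⟩
    exact ⟨_, ⟨w, hw, w', hw', rfl⟩, rfl⟩
  · rintro ⟨_, ⟨w, hw, w', hw', rfl⟩, rfl⟩
    exact ⟨w, hw, w', hw', rfl⟩

/-- linear-constraint case. If `ã` is optimistically feasible, `‖ã‖ ≤ D_a`,
`γ ∈ [0,1]` with `γ ≥ b/(b + Δ_W(ã))`, and `ℓ` is `D_ℓ`-Lipschitz, then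
`ℓ(γ ã) − ℓ(ã) ≤ (D_ℓ D_a / b) · Δ_W(γ ã)`. -/
theorem linear_scaling_loss_increase_bound
    {d : ℕ} (W : Set (EuclideanSpace ℝ (Fin d))) (hne : W.Nonempty)
    (hW : ∀ w ∈ W, ‖w‖ ≤ 1) (b Da Dl : ℝ) (hb : 0 < b) (hDa : 0 < Da) (hDl : 0 ≤ Dl)
    (atil : EuclideanSpace ℝ (Fin d)) (hnorm : ‖atil‖ ≤ Da)
    (hopt : sInf {y : ℝ | ∃ w ∈ W, y = ⟪w, atil⟫} ≤ b)
    (γ : ℝ) (hγ : γ ∈ Set.Icc (0 : ℝ) 1) (hγlb : b / (b + linWidth W atil) ≤ γ)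
    (ℓ : EuclideanSpace ℝ (Fin d) → ℝ)
    (hLip : ∀ x y, dist (ℓ x) (ℓ y) ≤ Dl * dist x y) :
    ℓ (γ • atil) - ℓ atil ≤ (Dl * Da / b) * linWidth W (γ • atil) := by
  have hΔ := linWidth_nonneg hne atil
  rw [linWidth_smul W hγ.1]
  have hscale : (1 - γ) * b ≤ γ * linWidth W atil := by
    rw [div_le_iff₀ (by positivity)] at hγlb
    linarith
  have hdist : dist (γ • atil) atil = (1 - γ) * ‖atil‖ := by
    rw [dist_comm, dist_eq_norm, show atil - γ • atil = (1 - γ) • atil by module, norm_smul,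
      Real.norm_of_nonneg (sub_nonneg.2 hγ.2)]
  have hγ' : 0 ≤ 1 - γ := sub_nonneg.2 hγ.2
  calc ℓ (γ • atil) - ℓ atil ≤ dist (ℓ (γ • atil)) (ℓ atil) := le_abs_self _
    _ ≤ Dl * ((1 - γ) * ‖atil‖) := hdist ▸ hLip _ _
    _ ≤ Dl * ((1 - γ) * Da) := by gcongr
    _ = Dl * Da / b * ((1 - γ) * b) := by field_simp
    _ ≤ Dl * Da / b * (γ * linWidth W atil) := by gcongr
end

section
/- Let σ : ℝ → ℝ be differentiable and non-decreasing with σ(0) = 0 and σ'(x) ≥ c > 0 for all x. Let W be a nonempty set of vectors in ℝ^d with ‖w‖ ≤ 1 for all w ∈ W, let b > 0, and let ã ∈ ℝ^d satisfy inf_{w ∈ W} σ(⟨w, ã⟩ − b) ≤ 0. Set Δ(ã) := sup_{w,w' ∈ W} (σ(⟨w, ã⟩ − b) − σ(⟨w', ã⟩ − b)) and α := b / (b + Δ(ã)/c). Then for every w ∈ W, σ(⟨w, α ã⟩ − b) ≤ 0. -/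
open RealInnerProductSpace

/-- Width of the generalized-linear class `{a ↦ σ(⟨w, a⟩ − b) : w ∈ W}` at `a`:
`Δ(a) = sup_{w,w' ∈ W} (σ(⟨w, a⟩ − b) − σ(⟨w', a⟩ − b))`. -/
noncomputable def glWidth {d : ℕ} (σ : ℝ → ℝ) (b : ℝ) (W : Set (EuclideanSpace ℝ (Fin d)))
    (a : EuclideanSpace ℝ (Fin d)) : ℝ :=
  sSup {y : ℝ | ∃ w ∈ W, ∃ w' ∈ W, y = σ (⟪w, a⟫ - b) - σ (⟪w', a⟫ - b)}

/-- The set of value differences defining `glWidth` is bounded above when the parameters lie in the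
unit ball and the link function is monotone. -/
theorem bddAbove_glWidth_set {d : ℕ} {σ : ℝ → ℝ} (hmono : Monotone σ) (b : ℝ)
    {W : Set (EuclideanSpace ℝ (Fin d))} (hW : ∀ w ∈ W, ‖w‖ ≤ 1)
    (a : EuclideanSpace ℝ (Fin d)) :
    BddAbove {y : ℝ | ∃ w ∈ W, ∃ w' ∈ W, y = σ (⟪w, a⟫ - b) - σ (⟪w', a⟫ - b)} := by
  have habs : ∀ w ∈ W, |⟪w, a⟫| ≤ ‖a‖ := fun w hw =>
    (abs_real_inner_le_norm w a).trans (mul_le_of_le_one_left (norm_nonneg a) (hW w hw))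
  refine ⟨σ (‖a‖ - b) - σ (-‖a‖ - b), ?_⟩
  rintro y ⟨w, hw, w', hw', rfl⟩
  exact sub_le_sub (hmono (sub_le_sub_right (abs_le.mp (habs w hw)).2 b))
    (hmono (sub_le_sub_right (abs_le.mp (habs w' hw')).1 b))

/-- generalized linear constraints. If `σ` is differentiable, non-decreasing,
`σ(0) = 0` and `σ' ≥ c > 0`, `W` nonempty with `‖w‖ ≤ 1`, `b > 0`, and
`inf_{w ∈ W} σ(⟨w, ã⟩ − b) ≤ 0`, then with `α = b / (b + Δ(ã)/c)` we have
`σ(⟨w, α ã⟩ − b) ≤ 0` for every `w ∈ W`. -/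
theorem glm_scaled_action_pessimistically_safe
    {d : ℕ} (σ : ℝ → ℝ) (hdiff : Differentiable ℝ σ) (hmono : Monotone σ)
    (hσ0 : σ 0 = 0) (c : ℝ) (hc : 0 < c) (hderiv : ∀ x : ℝ, c ≤ deriv σ x)
    (W : Set (EuclideanSpace ℝ (Fin d))) (hne : W.Nonempty)
    (hW : ∀ w ∈ W, ‖w‖ ≤ 1) (b : ℝ) (hb : 0 < b)
    (atil : EuclideanSpace ℝ (Fin d))
    (hopt : sInf {y : ℝ | ∃ w ∈ W, y = σ (⟪w, atil⟫ - b)} ≤ 0) :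
    ∀ w ∈ W, σ (⟪w, (b / (b + glWidth σ b W atil / c)) • atil⟫ - b) ≤ 0 := by
  intro w hw
  have hle : ∀ w' ∈ W, σ (⟪w, atil⟫ - b) - σ (⟪w', atil⟫ - b) ≤ glWidth σ b W atil :=
    fun w' hw' => le_csSup (bddAbove_glWidth_set hmono b hW atil) ⟨w, hw, w', hw', rfl⟩
  have hwidth : 0 ≤ glWidth σ b W atil := by simpa using hle w hw
  have hvalue : σ (⟪w, atil⟫ - b) ≤ glWidth σ b W atil := by
    have hinf : σ (⟪w, atil⟫ - b) - glWidth σ b W atil ≤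
        sInf {y : ℝ | ∃ w ∈ W, y = σ (⟪w, atil⟫ - b)} := by
      refine le_csInf ⟨_, w, hw, rfl⟩ ?_
      rintro y ⟨w', hw', rfl⟩
      linarith [hle w' hw']
    linarith
  have hslack : ⟪w, atil⟫ - b ≤ glWidth σ b W atil / c := by
    rcases le_total (⟪w, atil⟫ - b) 0 with hx | hx
    · exact hx.trans (by positivity)
    · have := mul_sub_le_image_sub_of_le_deriv hdiff hderiv hx
      rw [le_div_iff₀ hc]
      linarith
  have hpos : 0 < b + glWidth σ b W atil / c := by positivity
  refine (hmono ?_).trans_eq hσ0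
  rw [real_inner_smul_right, sub_nonpos, div_mul_eq_mul_div, div_le_iff₀ hpos]
  exact mul_le_mul_of_nonneg_left (by linarith) hb.le
end

section
/- Let σ : ℝ → ℝ be differentiable with c ≤ σ'(x) ≤ C for all x, where 0 < c ≤ C. Let W be a nonempty set of vectors in ℝ^d, let b ∈ ℝ, and define Δ(a) := sup_{w,w' ∈ W} (σ(⟨w, a⟩ − b) − σ(⟨w', a⟩ − b)). Then for every a ∈ ℝ^d and every α ∈ [0,1], the width at the scaled action satisfies Δ(α a) ≥ (c/C) · α · Δ(a). -/
open RealInnerProductSpace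

section DerivBounds

variable {σ : ℝ → ℝ} {c C : ℝ}

/-- Increments of a function with derivative in `[c, C]` over two intervals whose lengths have
ratio `α` are comparable up to the factor `c / C`. -/
theorem div_mul_mul_increment_le (hdiff : Differentiable ℝ σ) (hc : 0 < c) (hC : 0 < C)
    (hderiv : ∀ x, c ≤ deriv σ x ∧ deriv σ x ≤ C) {α x y x' y' : ℝ} (hα : 0 ≤ α) (hxy : x ≤ y)
    (hlen : y' - x' = α * (y - x)) :
    c / C * α * (σ y - σ x) ≤ σ y' - σ x' := by
  have hxy' : x' ≤ y' := sub_nonneg.mp (hlen ▸ mul_nonneg hα (sub_nonneg.mpr hxy))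
  calc c / C * α * (σ y - σ x) ≤ c / C * α * (C * (y - x)) := by
        gcongr
        exact image_sub_le_mul_sub_of_deriv_le hdiff (fun z => (hderiv z).2) hxy
    _ = c * (y' - x') := by rw [hlen]; field_simp
    _ ≤ σ y' - σ x' := mul_sub_le_image_sub_of_le_deriv hdiff (fun z => (hderiv z).1) hxy'

theorem increment_le_div_mul_mul (hdiff : Differentiable ℝ σ) (hc : 0 < c) (hC : 0 < C)
    (hderiv : ∀ x, c ≤ deriv σ x ∧ deriv σ x ≤ C) {α x y x' y' : ℝ} (hα : 0 ≤ α) (hxy : x ≤ y)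
    (hlen : y' - x' = α * (y - x)) :
    σ y' - σ x' ≤ C / c * α * (σ y - σ x) := by
  have hxy' : x' ≤ y' := sub_nonneg.mp (hlen ▸ mul_nonneg hα (sub_nonneg.mpr hxy))
  calc σ y' - σ x' ≤ C * (y' - x') :=
        image_sub_le_mul_sub_of_deriv_le hdiff (fun z => (hderiv z).2) hxy'
    _ = C / c * α * (c * (y - x)) := by rw [hlen]; field_simp
    _ ≤ C / c * α * (σ y - σ x) := by
        gcongr
        exact mul_sub_le_image_sub_of_le_deriv hdiff (fun z => (hderiv z).1) hxy

end DerivBounds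

theorem glWidth_nonneg {d : ℕ} (σ : ℝ → ℝ) (b : ℝ) {W : Set (EuclideanSpace ℝ (Fin d))}
    (hne : W.Nonempty) (a : EuclideanSpace ℝ (Fin d)) : 0 ≤ glWidth σ b W a := by
  obtain ⟨w, hw⟩ := hne
  exact Real.sSup_nonneg' ⟨0, ⟨w, hw, w, hw, (sub_self _).symm⟩, le_rfl⟩

/-- if `σ` is differentiable with `c ≤ σ' ≤ C` (`0 < c ≤ C`), then for every
action `a` and every `α ∈ [0,1]`, the width at the scaled action satisfies
`Δ(α a) ≥ (c/C) · α · Δ(a)`. -/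
theorem glm_width_scaling_lower_bound
    {d : ℕ} (σ : ℝ → ℝ) (hdiff : Differentiable ℝ σ)
    (c C : ℝ) (hc : 0 < c) (hcC : c ≤ C)
    (hderiv : ∀ x : ℝ, c ≤ deriv σ x ∧ deriv σ x ≤ C)
    (W : Set (EuclideanSpace ℝ (Fin d))) (hne : W.Nonempty) (b : ℝ) :
    ∀ a : EuclideanSpace ℝ (Fin d), ∀ α ∈ Set.Icc (0 : ℝ) 1,
      (c / C) * α * glWidth σ b W a ≤ glWidth σ b W (α • a) := by
  intro a α ⟨hα, _⟩
  have hC : 0 < C := hc.trans_le hcC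
  have hmono : Monotone σ := monotone_of_deriv_nonneg hdiff fun x => hc.le.trans (hderiv x).1
  have hlen (w w' : EuclideanSpace ℝ (Fin d)) :
      (⟪w, α • a⟫ - b) - (⟪w', α • a⟫ - b) = α * ((⟪w, a⟫ - b) - (⟪w', a⟫ - b)) := by
    rw [real_inner_smul_right, real_inner_smul_right]
    ring
  have hnonneg := glWidth_nonneg σ b hne (α • a)
  by_cases hbdd : BddAbove {y : ℝ | ∃ w ∈ W, ∃ w' ∈ W,
      y = σ (⟪w, α • a⟫ - b) - σ (⟪w', α • a⟫ - b)}
  · rcases hα.eq_or_lt with rfl | hα'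
    · simpa using hnonneg
    have hk : 0 < c / C * α := by positivity
    rw [mul_comm, ← le_div_iff₀ hk]
    refine Real.sSup_le ?_ (div_nonneg hnonneg hk.le)
    rintro _ ⟨w, hw, w', hw', rfl⟩
    rw [le_div_iff₀ hk, mul_comm]
    rcases le_total (⟪w', a⟫ - b) (⟪w, a⟫ - b) with h | h
    · exact (div_mul_mul_increment_le hdiff hc hC hderiv hα h (hlen w w')).trans
        (le_csSup hbdd ⟨w, hw, w', hw', rfl⟩)
    · exact (mul_nonpos_of_nonneg_of_nonpos hk.le (sub_nonpos.mpr (hmono h))).trans hnonneg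
  · suffices h : glWidth σ b W a = 0 by rwa [h, mul_zero]
    refine Real.sSup_of_not_bddAbove fun ⟨M, hM⟩ => hbdd ⟨C / c * α * M, ?_⟩
    have hM0 : 0 ≤ M := by
      obtain ⟨w, hw⟩ := hne
      exact hM ⟨w, hw, w, hw, (sub_self _).symm⟩
    rintro _ ⟨w, hw, w', hw', rfl⟩
    rcases le_total (⟪w', a⟫ - b) (⟪w, a⟫ - b) with h | h
    · refine (increment_le_div_mul_mul hdiff hc hC hderiv hα h (hlen w w')).trans ?_
      gcongr
      exact hM ⟨w, hw, w', hw', rfl⟩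
    · have h' : ⟪w, α • a⟫ - b ≤ ⟪w', α • a⟫ - b := by
        rw [← sub_nonpos, hlen]
        exact mul_nonpos_of_nonneg_of_nonpos hα (sub_nonpos.mpr h)
      exact (sub_nonpos.mpr (hmono h')).trans (by positivity)
end

section
/- Let W_1, …, W_m be nonempty sets of vectors in ℝ^d with ‖w‖ ≤ 1 for every w ∈ W_i and every i ∈ [m], let b > 0, and let ã ∈ ℝ^d satisfy inf_{w ∈ W_i} ⟨w, ã⟩ ≤ b for every i ∈ [m]. Define Δ(ã) := max_{i ∈ [m]} sup_{w,w' ∈ W_i} ⟨w − w', ã⟩ and α := b / (b + Δ(ã)). Then for every i ∈ [m] and every w ∈ W_i, ⟨w, α ã⟩ ≤ b. -/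
open RealInnerProductSpace

/-- Combined width for `m` simultaneous linear constraints:
`Δ(a) = max_{i ∈ [m]} Δ_{W_i}(a)`. -/
noncomputable def multiWidth {d m : ℕ} (W : Fin m → Set (EuclideanSpace ℝ (Fin d)))
    (a : EuclideanSpace ℝ (Fin d)) : ℝ :=
  ⨆ i : Fin m, linWidth (W i) a

theorem linWidth_le_multiWidth {d m : ℕ} (W : Fin m → Set (EuclideanSpace ℝ (Fin d)))
    (a : EuclideanSpace ℝ (Fin d)) (i : Fin m) : linWidth (W i) a ≤ multiWidth W a :=
  le_ciSup (f := fun i => linWidth (W i) a) (Set.finite_range _).bddAbove i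

/-- polytopic constraints. If each `W_i` is nonempty with vectors of norm at
most `1`, `b > 0`, and `ã` is optimistically feasible for each constraint
(`inf_{w ∈ W_i} ⟨w, ã⟩ ≤ b`), then with `α = b / (b + Δ(ã))` where
`Δ(ã) = max_i Δ_{W_i}(ã)`, the scaled action is pessimistically safe for all constraints:
`⟨w, α ã⟩ ≤ b` for every `i` and `w ∈ W_i`. -/
theorem poly_scaled_action_pessimistically_safe
    {d m : ℕ} (hm : 0 < m) (W : Fin m → Set (EuclideanSpace ℝ (Fin d)))
    (hne : ∀ i, (W i).Nonempty)
    (hW : ∀ i, ∀ w ∈ W i, ‖w‖ ≤ 1) (b : ℝ) (hb : 0 < b)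
    (atil : EuclideanSpace ℝ (Fin d))
    (hopt : ∀ i, sInf {y : ℝ | ∃ w ∈ W i, y = ⟪w, atil⟫} ≤ b) :
    ∀ i, ∀ w ∈ W i, ⟪w, (b / (b + multiWidth W atil)) • atil⟫ ≤ b := by
  intro i w hw
  have hdiff : ∀ w' ∈ W i, ⟪w - w', atil⟫ ≤ multiWidth W atil := fun w' hw' =>
    (inner_sub_le_linWidth (hW i) atil hw hw').trans (linWidth_le_multiWidth W atil i)
  have hwidth : 0 ≤ multiWidth W atil := by simpa using hdiff w hw
  have hinf : ⟪w, atil⟫ - multiWidth W atil ≤ sInf {y : ℝ | ∃ w ∈ W i, y = ⟪w, atil⟫} := by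
    refine le_csInf ⟨_, w, hw, rfl⟩ ?_
    rintro _ ⟨w', hw', rfl⟩
    have h := hdiff w' hw'
    rw [inner_sub_left] at h
    linarith
  have hle : ⟪w, atil⟫ ≤ b + multiWidth W atil := by linarith [hopt i]
  rw [real_inner_smul_right, div_mul_eq_mul_div, div_le_iff₀ (by linarith)]
  exact mul_le_mul_of_nonneg_left hle hb.le
end

section
/- Fix T ≥ 1, D_a > 0, D_f > 0, and set η := 2 D_a / (D_f √T). Let C_1, …, C_T be nonempty closed convex subsets of ℝ^d, each contained in the closed Euclidean ball of radius D_a, and let a* ∈ ∩_{t=1}^T C_t. Let f_1, …, f_T ∈ ℝ^d with ‖f_t‖ ≤ D_f for all t. Let ā_1 ∈ C_1 and, for each t ∈ [T−1], let ā_{t+1} be the (unique) nearest point of C_{t+1} to ā_t − η f_t. Then Σ_{t=1}^T ⟨f_t, ā_t − a*⟩ ≤ 2 D_a D_f √T. -/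
open RealInnerProductSpace

theorem norm_sub_le_of_isNearest {E : Type*} [NormedAddCommGroup E] [InnerProductSpace ℝ E]
    {K : Set E} (hK : Convex ℝ K) {p v y : E} (hv : v ∈ K) (hy : y ∈ K)
    (hmin : ∀ w ∈ K, ‖v - p‖ ≤ ‖w - p‖) : ‖v - y‖ ≤ ‖p - y‖ := by
  have : Nonempty K := ⟨⟨v, hv⟩⟩
  have hinf : ‖p - v‖ = ⨅ w : K, ‖p - w‖ := by
    refine le_antisymm (le_ciInf fun w => ?_)
      (ciInf_le (f := fun w : K => ‖p - w‖) ⟨0, ?_⟩ ⟨v, hv⟩)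
    · rw [norm_sub_rev p, norm_sub_rev p]
      exact hmin w w.2
    · rintro _ ⟨w, rfl⟩
      exact norm_nonneg _
  have hinner := (norm_eq_iInf_iff_real_inner_le_zero hK hv).1 hinf y hy
  have hexp := norm_sub_sq_real (p - v) (y - v)
  rw [sub_sub_sub_cancel_right, norm_sub_rev y v] at hexp
  exact le_of_sq_le_sq (by nlinarith [sq_nonneg ‖p - v‖]) (norm_nonneg _)

theorem norm_sub_smul_sub_sq_le {E : Type*} [NormedAddCommGroup E] [InnerProductSpace ℝ E]
    (a b g : E) (η : ℝ) {G : ℝ} (hg : ‖g‖ ≤ G) :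
    2 * η * ⟪g, a - b⟫ + ‖a - η • g - b‖ ^ 2 ≤ ‖a - b‖ ^ 2 + η ^ 2 * G ^ 2 := by
  rw [sub_right_comm, norm_sub_sq_real, real_inner_smul_right, norm_smul, mul_pow,
    Real.norm_eq_abs, sq_abs, real_inner_comm]
  have : ‖g‖ ^ 2 ≤ G ^ 2 := pow_le_pow_left₀ (norm_nonneg _) hg 2
  nlinarith [mul_le_mul_of_nonneg_left this (sq_nonneg η)]

/-- Regret of projected online gradient descent with an arbitrary step size. -/
theorem two_mul_sum_inner_le_of_projected_steps {E : Type*} [NormedAddCommGroup E]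
    [InnerProductSpace ℝ E] (n : ℕ) (η G : ℝ) (C : ℕ → Set E)
    (hC : ∀ t < n + 1, Convex ℝ (C t)) (b : E) (hb : ∀ t < n + 1, b ∈ C t)
    (g : ℕ → E) (hg : ∀ t < n + 1, ‖g t‖ ≤ G) (a : ℕ → E)
    (ha : ∀ t, t + 1 < n + 1 → a (t + 1) ∈ C (t + 1) ∧
      ∀ y ∈ C (t + 1), ‖a (t + 1) - (a t - η • g t)‖ ≤ ‖y - (a t - η • g t)‖) :
    2 * η * ∑ t ∈ Finset.range (n + 1), ⟪g t, a t - b⟫ + ‖a n - η • g n - b‖ ^ 2 ≤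
      ‖a 0 - b‖ ^ 2 + (n + 1) * (η ^ 2 * G ^ 2) := by
  induction n with
  | zero => simpa using norm_sub_smul_sub_sq_le (a 0) b (g 0) η (hg 0 one_pos)
  | succ n ih =>
    have ih := ih (fun t ht => hC t (by lia)) (fun t ht => hb t (by lia))
      (fun t ht => hg t (by lia)) (fun t ht => ha t (by lia))
    obtain ⟨hmem, hmin⟩ := ha n (by lia)
    have hcontr := norm_sub_le_of_isNearest (hC (n + 1) (by lia)) hmem (hb (n + 1) (by lia)) hmin
    have hsq := pow_le_pow_left₀ (norm_nonneg _) hcontr 2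
    have hstep := norm_sub_smul_sub_sq_le (a (n + 1)) b (g (n + 1)) η (hg (n + 1) (by lia))
    rw [Finset.sum_range_succ]
    push_cast
    linarith

/-- projected online gradient descent with time-varying closed convex sets
`C_t ⊆ closedBall 0 D_a`, gradients `‖f_t‖ ≤ D_f`, step size `η = 2 D_a / (D_f √T)`, and a
comparator `a* ∈ ∩_t C_t`. The iterates `ā_{t+1} = Π_{C_{t+1}}(ā_t − η f_t)` satisfy
`∑_{t<T} ⟨f_t, ā_t − a*⟩ ≤ 2 D_a D_f √T`. -/
theorem projected_ogd_regret
    {d : ℕ} (T : ℕ) (hT : 1 ≤ T) (Da Df : ℝ) (hDa : 0 < Da) (hDf : 0 < Df)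
    (C : ℕ → Set (EuclideanSpace ℝ (Fin d)))
    (hCne : ∀ t < T, (C t).Nonempty)
    (hCclosed : ∀ t < T, IsClosed (C t))
    (hCconv : ∀ t < T, Convex ℝ (C t))
    (hCball : ∀ t < T, C t ⊆ Metric.closedBall 0 Da)
    (astar : EuclideanSpace ℝ (Fin d)) (hastar : ∀ t < T, astar ∈ C t)
    (f : ℕ → EuclideanSpace ℝ (Fin d)) (hf : ∀ t < T, ‖f t‖ ≤ Df)
    (abar : ℕ → EuclideanSpace ℝ (Fin d))
    (habar0 : abar 0 ∈ C 0)
    (hproj : ∀ t, t + 1 < T →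
      abar (t + 1) ∈ C (t + 1) ∧
        ∀ y ∈ C (t + 1),
          ‖abar (t + 1) - (abar t - (2 * Da / (Df * Real.sqrt T)) • f t)‖ ≤
            ‖y - (abar t - (2 * Da / (Df * Real.sqrt T)) • f t)‖) :
    ∑ t ∈ Finset.range T, ⟪f t, abar t - astar⟫ ≤ 2 * Da * Df * Real.sqrt T := by
  obtain ⟨n, rfl⟩ : ∃ n, T = n + 1 := ⟨T - 1, by lia⟩
  have hsum := two_mul_sum_inner_le_of_projected_steps n _ Df C hCconv astar hastar f hf abar hproj
  have hdiam : ‖abar 0 - astar‖ ^ 2 ≤ (2 * Da) ^ 2 := by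
    refine pow_le_pow_left₀ (norm_nonneg _) ((norm_sub_le _ _).trans ?_) 2
    have h₀ := mem_closedBall_zero_iff.1 (hCball 0 hT habar0)
    have h₁ := mem_closedBall_zero_iff.1 (hCball 0 hT (hastar 0 hT))
    linarith
  have hcast : (n : ℝ) + 1 = Real.sqrt ((n + 1 : ℕ) : ℝ) ^ 2 := by
    rw [Real.sq_sqrt (Nat.cast_nonneg _)]
    push_cast
    rfl
  have hr : 0 < Real.sqrt ((n + 1 : ℕ) : ℝ) := Real.sqrt_pos.2 (by positivity)
  rw [hcast] at hsum
  set r := Real.sqrt ((n + 1 : ℕ) : ℝ)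
  set S := ∑ t ∈ Finset.range (n + 1), ⟪f t, abar t - astar⟫
  have hη : 0 < 2 * Da / (Df * r) := by positivity
  have hvar : r ^ 2 * ((2 * Da / (Df * r)) ^ 2 * Df ^ 2) = (2 * Da) ^ 2 := by field_simp
  have hbound : 2 * (2 * Da / (Df * r)) * (2 * Da * Df * r) = 2 * (2 * Da) ^ 2 := by
    field_simp
  refine le_of_mul_le_mul_left ?_ (mul_pos two_pos hη)
  rw [hbound]
  linarith [sq_nonneg ‖abar n - (2 * Da / (Df * r)) • f n - astar‖]
end

section
/- Fix T ≥ 1, D_a > 0, D_f > 0, δ ∈ (0,1), and set η := 2 D_a / (D_f √T). Let C_1, …, C_T be nonempty closed convex subsets of ℝ^d, each contained in the closed Euclidean ball of radius D_a, with ∩_{t=1}^T C_t nonempty, and let f_1, …, f_T ∈ ℝ^d with ‖f_t‖ ≤ D_f for all t. Consider the randomized algorithm that maintains ā_1 ∈ C_1 and ā_{t+1} := Π_{C_{t+1}}(ā_t − η f_t), and at each round t samples a random action ã_t that lies in C_t almost surely and satisfies E[ã_t | 𝓕_{t−1}] = ā_t, where 𝓕_{t−1} is the σ-algebra generated by the randomness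 up to round t−1. Then with probability at least 1 − δ, Σ_{t=1}^T ⟨f_t, ã_t⟩ − min_{a ∈ ∩_{t=1}^T C_t} Σ_{t=1}^T ⟨f_t, a⟩ ≤ 4 D_f D_a √(T log(2/δ)). -/
open MeasureTheory RealInnerProductSpace

/-- Moving to the nearest point of a convex set does not increase the squared distance to any
point of the set. -/
lemma norm_sub_sq_le_of_forall_norm_sub_le {E : Type*} [NormedAddCommGroup E]
    [InnerProductSpace ℝ E] {K : Set E} (hK : Convex ℝ K) {p q u : E} (hq : q ∈ K)
    (hmin : ∀ y ∈ K, ‖q - p‖ ≤ ‖y - p‖) (hu : u ∈ K) :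
    ‖q - u‖ ^ 2 ≤ ‖p - u‖ ^ 2 := by
  have hinf : ‖p - q‖ = ⨅ w : K, ‖p - w‖ := by
    have : Nonempty K := ⟨⟨q, hq⟩⟩
    refine le_antisymm (le_ciInf fun w => ?_) (ciInf_le ⟨0, ?_⟩ (⟨q, hq⟩ : K))
    · rw [norm_sub_rev p q, norm_sub_rev p w]
      exact hmin w w.2
    · rintro _ ⟨w, rfl⟩
      exact norm_nonneg _
  have hinner := (norm_eq_iInf_iff_real_inner_le_zero hK hq).1 hinf u hu
  have hsq := norm_sub_sq_real (p - q) (u - q)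
  rw [sub_sub_sub_cancel_right, norm_sub_rev u q] at hsq
  nlinarith [sq_nonneg ‖p - q‖]

/-- Regret bound of online projected gradient descent with linear losses `f t`, step size `η` and
time-varying convex feasible sets `C t`, against a comparator `u` feasible in every round. -/
lemma projected_gradient_regret_le {E : Type*} [NormedAddCommGroup E] [InnerProductSpace ℝ E]
    {C : ℕ → Set E} {T : ℕ} (hC : ∀ t < T, Convex ℝ (C t)) {f a : ℕ → E} {η G : ℝ}
    (hf : ∀ t < T, ‖f t‖ ≤ G)
    (hproj : ∀ t, t + 1 < T → a (t + 1) ∈ C (t + 1) ∧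
      ∀ y ∈ C (t + 1), ‖a (t + 1) - (a t - η • f t)‖ ≤ ‖y - (a t - η • f t)‖)
    {u : E} (hu : ∀ t < T, u ∈ C t) :
    2 * η * ∑ t ∈ Finset.range T, ⟪f t, a t - u⟫ ≤ ‖a 0 - u‖ ^ 2 + T * (η ^ 2 * G ^ 2) := by
  have hstep : ∀ t < T,
      2 * η * ⟪f t, a t - u⟫ + ‖a t - η • f t - u‖ ^ 2 ≤ ‖a t - u‖ ^ 2 + η ^ 2 * G ^ 2 := by
    intro t ht
    have hsq := norm_sub_sq_real (a t - u) (η • f t)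
    rw [sub_right_comm, real_inner_smul_right, real_inner_comm, norm_smul, mul_pow,
      Real.norm_eq_abs, sq_abs] at hsq
    have hG : ‖f t‖ ^ 2 ≤ G ^ 2 := pow_le_pow_left₀ (norm_nonneg _) (hf t ht) 2
    nlinarith [mul_le_mul_of_nonneg_left hG (sq_nonneg η)]
  have hpartial : ∀ n < T, 2 * η * ∑ t ∈ Finset.range n, ⟪f t, a t - u⟫ + ‖a n - u‖ ^ 2 ≤
      ‖a 0 - u‖ ^ 2 + n * (η ^ 2 * G ^ 2) := by
    intro n
    induction n with
    | zero => simp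
    | succ n ih =>
      intro hn
      have hlt := (Nat.lt_succ_self n).trans hn
      have hdist := norm_sub_sq_le_of_forall_norm_sub_le (hC _ hn) (hproj n hn).1
        (hproj n hn).2 (hu _ hn)
      rw [Finset.sum_range_succ]
      push_cast
      linarith [ih hlt, hstep n hlt]
  rcases T with _ | n
  · simp
  · rw [Finset.sum_range_succ]
    push_cast
    linarith [hpartial n n.lt_succ_self, hstep n n.lt_succ_self,
      sq_nonneg ‖a n - η • f n - u‖]

section Azuma

variable {Ω : Type*} {m0 : MeasurableSpace Ω} {P : Measure Ω} [IsProbabilityMeasure P]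
  {ℱ : Filtration ℕ m0} {T : ℕ} {b : ℝ} {X : ℕ → Ω → ℝ}

/-- The moment generating function of a sum of martingale differences bounded by `b`. -/
lemma integral_exp_sum_le_of_condExp_eq_zero (hb : 0 < b)
    (hmeas : ∀ t < T, StronglyMeasurable[ℱ (t + 1)] (X t))
    (hbound : ∀ t < T, ∀ᵐ ω ∂P, |X t ω| ≤ b) (hcond : ∀ t < T, P[X t|ℱ t] =ᵐ[P] 0) (l : ℝ) :
    ∀ n ≤ T, Integrable (fun ω => Real.exp (l * ∑ t ∈ Finset.range n, X t ω)) P ∧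
      ∫ ω, Real.exp (l * ∑ t ∈ Finset.range n, X t ω) ∂P ≤
        Real.exp (n * ((b * l) ^ 2 / 2)) := by
  intro n
  induction n with
  | zero => simp
  | succ n ih =>
    intro hn
    obtain ⟨hint, hle⟩ := ih (by omega)
    set M : Ω → ℝ := fun ω => Real.exp (l * ∑ t ∈ Finset.range n, X t ω) with hM
    have hXm : AEStronglyMeasurable (X n) P := ((hmeas n hn).mono (ℱ.le _)).aestronglyMeasurable
    have hXint : Integrable (X n) P := .of_bound hXm b (by simpa using hbound n hn)
    have hMX : Integrable (fun ω => M ω * X n ω) P :=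
      hint.mul_bdd (c := b) hXm (by simpa using hbound n hn)
    have hMm : StronglyMeasurable[ℱ n] M := by
      refine Real.continuous_exp.comp_stronglyMeasurable (StronglyMeasurable.const_mul ?_ l)
      refine Finset.stronglyMeasurable_fun_sum _ fun t ht => ?_
      have htn := Finset.mem_range.1 ht
      exact (hmeas t (by omega)).mono (ℱ.mono htn)
    have hzero : ∫ ω, M ω * X n ω ∂P = 0 := by
      rw [← integral_condExp (ℱ.le n)]
      have hpull := condExp_mul_of_stronglyMeasurable_left hMm hMX hXint
      rw [integral_congr_ae (g := fun _ => 0), integral_zero]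
      filter_upwards [hpull, hcond n hn] with ω h1 h2
      exact h1.trans (by simp [h2])
    have hsucc : ∀ ω, Real.exp (l * ∑ t ∈ Finset.range (n + 1), X t ω) =
        M ω * Real.exp (l * X n ω) := fun ω => by
      rw [Finset.sum_range_succ, mul_add, Real.exp_add]
    have hconv : ∀ᵐ ω ∂P, M ω * Real.exp (l * X n ω) ≤
        Real.cosh (b * l) * M ω + Real.sinh (b * l) / b * (M ω * X n ω) := by
      filter_upwards [hbound n hn] with ω hω
      have hunit : |X n ω / b| ≤ 1 := by
        rwa [abs_div, abs_of_pos hb, div_le_one hb]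
      have hcosh := Real.exp_mul_le_cosh_add_mul_sinh hunit (b * l)
      rw [show X n ω / b * (b * l) = l * X n ω by field_simp] at hcosh
      calc M ω * Real.exp (l * X n ω)
          ≤ M ω * (Real.cosh (b * l) + X n ω / b * Real.sinh (b * l)) :=
            mul_le_mul_of_nonneg_left hcosh (Real.exp_pos _).le
        _ = _ := by ring
    have hRint : Integrable (fun ω => Real.cosh (b * l) * M ω +
        Real.sinh (b * l) / b * (M ω * X n ω)) P := (hint.const_mul _).add (hMX.const_mul _)
    have hLint : Integrable (fun ω => M ω * Real.exp (l * X n ω)) P := by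
      refine hRint.mono' (hint.aestronglyMeasurable.mul
        (Real.continuous_exp.comp_aestronglyMeasurable (hXm.const_mul l))) ?_
      filter_upwards [hconv] with ω hω
      rwa [Real.norm_of_nonneg (by positivity)]
    simp_rw [hsucc]
    refine ⟨hLint, (integral_mono_ae hLint hRint hconv).trans ?_⟩
    rw [integral_add (hint.const_mul _) (hMX.const_mul _), integral_const_mul,
      integral_const_mul, hzero, mul_zero, add_zero]
    push_cast
    rw [add_mul, one_mul, add_comm, Real.exp_add]
    exact mul_le_mul (Real.cosh_le_exp_half_sq _) hle (integral_nonneg fun ω => (Real.exp_pos _).le)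
      (Real.exp_pos _).le

/-- **Azuma-Hoeffding inequality** for martingale differences bounded by `b`. -/
lemma measure_sum_ge_le_of_condExp_eq_zero (hT : 0 < T) (hb : 0 < b)
    (hmeas : ∀ t < T, StronglyMeasurable[ℱ (t + 1)] (X t))
    (hbound : ∀ t < T, ∀ᵐ ω ∂P, |X t ω| ≤ b) (hcond : ∀ t < T, P[X t|ℱ t] =ᵐ[P] 0)
    {ε : ℝ} (hε : 0 ≤ ε) :
    P.real {ω | ε ≤ ∑ t ∈ Finset.range T, X t ω} ≤ Real.exp (-(ε ^ 2 / (2 * T * b ^ 2))) := by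
  have hT' : (0 : ℝ) < T := by exact_mod_cast hT
  set l : ℝ := ε / (T * b ^ 2) with hl
  obtain ⟨hint, hle⟩ := integral_exp_sum_le_of_condExp_eq_zero hb hmeas hbound hcond l T le_rfl
  refine (ProbabilityTheory.measure_ge_le_exp_mul_mgf ε (t := l) (by positivity) hint).trans ?_
  refine (mul_le_mul_of_nonneg_left hle (Real.exp_pos _).le).trans_eq ?_
  rw [← Real.exp_add]
  congr 1
  rw [hl]
  field_simp
  ring

end Azuma

/-- The numerical comparison of the descent and concentration terms with the final bound. -/
lemma two_mul_sqrt_add_two_mul_sqrt_le {T δ : ℝ} (hT : 0 ≤ T) (hδ : δ ∈ Set.Ioo (0 : ℝ) 1) :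
    2 * √T + 2 * √(2 * T * Real.log (1 / δ)) ≤ 4 * √(T * Real.log (2 / δ)) := by
  have hlog : Real.log (2 / δ) = Real.log 2 + Real.log (1 / δ) := by
    rw [← Real.log_mul (by norm_num) (one_div_ne_zero hδ.1.ne'), mul_one_div]
  have hpos : 0 ≤ Real.log (1 / δ) :=
    Real.log_nonneg ((one_le_div hδ.1).2 hδ.2.le)
  have hlog2 := Real.log_two_gt_d9
  rw [hlog]
  generalize Real.log (1 / δ) = x at *
  rw [mul_assoc, mul_left_comm 2 T x, Real.sqrt_mul hT, Real.sqrt_mul hT]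
  have hmain : 2 + 2 * √(2 * x) ≤ 4 * √(Real.log 2 + x) := by
    have h1 := Real.sq_sqrt (show 0 ≤ 2 * x by positivity)
    have h2 : (1 + √(2 * x)) / 2 ≤ √(Real.log 2 + x) := by
      apply Real.le_sqrt_of_sq_le
      nlinarith [sq_nonneg (√(2 * x) - 1)]
    linarith
  nlinarith [mul_le_mul_of_nonneg_left hmain (Real.sqrt_nonneg T)]

/-- regret guarantee of the randomized projected-OGD online learning oracle
for linear losses. The deterministic iterates satisfy `ā_1 ∈ C_1` and
`ā_{t+1} = Π_{C_{t+1}}(ā_t − η f_t)` with `η = 2 D_a/(D_f √T)` (the projection is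
characterized as the nearest point of the set), the random actions `ã_t` lie in `C_t` a.s.,
are `𝓕_{t+1}`-measurable, and have conditional mean `E[ã_t | 𝓕_t] = ā_t`. Then with
probability at least `1 − δ`,
`∑_{t<T} ⟨f_t, ã_t⟩ − min_{a ∈ ∩_t C_t} ∑_{t<T} ⟨f_t, a⟩ ≤ 4 D_f D_a √(T log(2/δ))`. -/
theorem randomized_ogd_oracle_regret
    {d : ℕ} {Ω : Type*} {m0 : MeasurableSpace Ω} (P : Measure Ω) [IsProbabilityMeasure P]
    (ℱ : Filtration ℕ m0)
    (T : ℕ) (hT : 1 ≤ T) (Da Df δ : ℝ) (hDa : 0 < Da) (hDf : 0 < Df)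
    (hδ : δ ∈ Set.Ioo (0 : ℝ) 1)
    (C : ℕ → Set (EuclideanSpace ℝ (Fin d)))
    (hCne : ∀ t < T, (C t).Nonempty)
    (hCclosed : ∀ t < T, IsClosed (C t))
    (hCconv : ∀ t < T, Convex ℝ (C t))
    (hCball : ∀ t < T, C t ⊆ Metric.closedBall 0 Da)
    (hInter : (⋂ t ∈ Finset.range T, C t).Nonempty)
    (f : ℕ → EuclideanSpace ℝ (Fin d)) (hf : ∀ t < T, ‖f t‖ ≤ Df)
    (abar : ℕ → EuclideanSpace ℝ (Fin d))
    (habar0 : abar 0 ∈ C 0)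
    (hproj : ∀ t, t + 1 < T →
      abar (t + 1) ∈ C (t + 1) ∧
        ∀ y ∈ C (t + 1),
          ‖abar (t + 1) - (abar t - (2 * Da / (Df * Real.sqrt T)) • f t)‖ ≤
            ‖y - (abar t - (2 * Da / (Df * Real.sqrt T)) • f t)‖)
    (atil : ℕ → Ω → EuclideanSpace ℝ (Fin d))
    (hmem : ∀ t < T, ∀ᵐ ω ∂P, atil t ω ∈ C t)
    (hmeas : ∀ t < T, StronglyMeasurable[ℱ (t + 1)] (atil t))
    (hcond : ∀ t < T, P[atil t|ℱ t] =ᵐ[P] fun _ => abar t) :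
    ENNReal.ofReal (1 - δ) ≤
      P {ω | ∑ t ∈ Finset.range T, ⟪f t, atil t ω⟫ -
              sInf ((fun a => ∑ t ∈ Finset.range T, ⟪f t, a⟫) ''
                ⋂ t ∈ Finset.range T, C t) ≤
            4 * Df * Da * Real.sqrt (T * Real.log (2 / δ))} := by
  have hT' : (0 : ℝ) < T := by exact_mod_cast hT
  have hsT : 0 < √(T : ℝ) := Real.sqrt_pos.2 hT'
  have hnorm : ∀ t < T, ∀ x ∈ C t, ‖x‖ ≤ Da := fun t ht x hx => by
    simpa using hCball t ht hx
  have hmemC : ∀ t < T, abar t ∈ C t := by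
    intro t ht
    rcases t with _ | t
    · exact habar0
    · exact (hproj t ht).1
  have hinner : ∀ t < T, ∀ x ∈ C t, |⟪f t, x⟫| ≤ Df * Da := fun t ht x hx =>
    (abs_real_inner_le_norm _ _).trans
      (mul_le_mul (hf t ht) (hnorm t ht x hx) (norm_nonneg _) hDf.le)
  have hdescent : ∀ u ∈ ⋂ t ∈ Finset.range T, C t,
      ∑ t ∈ Finset.range T, ⟪f t, abar t - u⟫ ≤ Df * Da * (2 * √T) := by
    intro u hu
    have huC : ∀ t < T, u ∈ C t := by simpa using hu
    have hreg := projected_gradient_regret_le hCconv hf hproj huC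
    have hdist : ‖abar 0 - u‖ ≤ 2 * Da := by
      linarith [norm_sub_le (abar 0) u, hnorm 0 hT _ habar0, hnorm 0 hT u (huC 0 hT)]
    have hdist2 := pow_le_pow_left₀ (norm_nonneg _) hdist 2
    have hη : (0 : ℝ) < 2 * (2 * Da / (Df * √T)) := by positivity
    refine le_of_mul_le_mul_left (hreg.trans ?_) hη
    have hsq : √(T : ℝ) ^ 2 = T := Real.sq_sqrt hT'.le
    have h1 : (T : ℝ) * ((2 * Da / (Df * √T)) ^ 2 * Df ^ 2) = 4 * Da ^ 2 := by
      rw [div_pow, mul_pow Df, hsq]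
      field_simp
      ring
    have h2 : 2 * (2 * Da / (Df * √T)) * (Df * Da * (2 * √T)) = 8 * Da ^ 2 := by
      field_simp
      ring
    rw [h1, h2]
    linarith
  set X : ℕ → Ω → ℝ := fun t ω => ⟪f t, atil t ω⟫ - ⟪f t, abar t⟫ with hX
  have hXmeas : ∀ t < T, StronglyMeasurable[ℱ (t + 1)] (X t) := fun t ht =>
    ((innerSL ℝ (f t)).continuous.comp_stronglyMeasurable (hmeas t ht)).sub
      stronglyMeasurable_const
  have hXbound : ∀ t < T, ∀ᵐ ω ∂P, |X t ω| ≤ 2 * (Df * Da) := by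
    intro t ht
    filter_upwards [hmem t ht] with ω hω
    refine (abs_sub _ _).trans ?_
    linarith [hinner t ht _ hω, hinner t ht _ (hmemC t ht)]
  have hXcond : ∀ t < T, P[X t|ℱ t] =ᵐ[P] 0 := by
    intro t ht
    have hint : Integrable (atil t) P := by
      refine .of_bound ((hmeas t ht).mono (ℱ.le _)).aestronglyMeasurable Da ?_
      filter_upwards [hmem t ht] with ω hω using hnorm t ht _ hω
    have hcomm := (innerSL ℝ (f t)).comp_condExp_add_const_comm (ℱ.le t) hint (-⟪f t, abar t⟫)
    filter_upwards [hcomm, hcond t ht] with ω h1 h2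
    simp only [innerSL_apply_apply, h2, add_neg_cancel, ← sub_eq_add_neg] at h1
    exact h1.symm
  set L := Real.log (1 / δ) with hL
  have hLnonneg : 0 ≤ L := Real.log_nonneg ((one_le_div hδ.1).2 hδ.2.le)
  set ε := 2 * (Df * Da) * √(2 * T * L) with hε
  have htail := measure_sum_ge_le_of_condExp_eq_zero hT (by positivity : 0 < 2 * (Df * Da))
    hXmeas hXbound hXcond (by positivity : 0 ≤ ε)
  have hexp : Real.exp (-(ε ^ 2 / (2 * T * (2 * (Df * Da)) ^ 2))) = δ := by
    rw [hε, mul_pow, Real.sq_sqrt (by positivity)]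
    have : (2 * (Df * Da)) ^ 2 * (2 * T * L) / (2 * T * (2 * (Df * Da)) ^ 2) = L := by
      field_simp
    rw [this, hL, one_div, Real.log_inv, neg_neg, Real.exp_log hδ.1]
  rw [hexp] at htail
  set good : Set Ω := {ω | ∑ t ∈ Finset.range T, ⟪f t, atil t ω⟫ -
    sInf ((fun a => ∑ t ∈ Finset.range T, ⟪f t, a⟫) '' ⋂ t ∈ Finset.range T, C t) ≤
      4 * Df * Da * Real.sqrt (T * Real.log (2 / δ))} with hgood
  have hcover : Set.univ ⊆ good ∪ {ω | ε ≤ ∑ t ∈ Finset.range T, X t ω} := by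
    intro ω _
    refine or_iff_not_imp_right.2 fun hω => ?_
    have hdev : ∑ t ∈ Finset.range T, X t ω < ε := not_le.1 hω
    rw [hgood, Set.mem_ofPred_eq, sub_le_comm]
    refine le_csInf (hInter.image _) ?_
    rintro _ ⟨u, hu, rfl⟩
    have hreg := hdescent u hu
    simp only [hX, inner_sub_right, Finset.sum_sub_distrib] at hdev hreg ⊢
    have hnum := mul_le_mul_of_nonneg_left (two_mul_sqrt_add_two_mul_sqrt_le hT'.le hδ)
      (mul_pos hDf hDa).le
    rw [← hL] at hnum
    rw [hε] at hdev
    linarith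
  have hone := (measureReal_mono hcover (measure_ne_top P _)).trans (measureReal_union_le _ _)
  rw [probReal_univ] at hone
  exact (ENNReal.ofReal_le_iff_le_toReal (measure_ne_top P _)).2
    (by change 1 - δ ≤ P.real good; linarith)
end
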